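/- Let n ≥ 2 be an integer. Every spherical code C in ℝ^n with maximal inner product 1/2 satisfies |C| ≤ 2·B((n−1)/2, 1/2) / B(1/4; (n−1)/2, 1/2). -/

import Mathlib

open scoped RealInnerProductSpace

/-- The incomplete beta function `B(x; y, z) = ∫_0^x t^(y-1) (1-t)^(z-1) dt`;
the (complete) beta function is `B(y, z) = incBeta 1 y z`. -/
noncomputable def incBeta (x y z : ℝ) : ℝ :=
  ∫ t in (0:ℝ)..x, t ^ (y - 1) * (1 - t) ^ (z - 1)

/-- A spherical code in `ℝ^n` with maximal inner product `t`: a finite set of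
unit vectors whose pairwise inner products are at most `t`. -/
def IsSphericalCode (n : ℕ) (t : ℝ) (C : Finset (EuclideanSpace ℝ (Fin n))) : Prop :=
  (∀ x ∈ C, ‖x‖ = 1) ∧ ∀ x ∈ C, ∀ y ∈ C, x ≠ y → ⟪x, y⟫ ≤ t

open MeasureTheory Set Module Measure
open scoped ENNReal

theorem lintegral_Ioo_sin_pow (m : ℕ) {θ : ℝ} (h0 : 0 ≤ θ) (hπ : θ ≤ Real.pi) :
    ∫⁻ φ in Ioo 0 θ, ENNReal.ofReal (Real.sin φ ^ m) =
      ENNReal.ofReal (∫ φ in (0 : ℝ)..θ, Real.sin φ ^ m) := by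
  have hint : IntegrableOn (fun φ ↦ Real.sin φ ^ m) (Ioc 0 θ) :=
    (Continuous.intervalIntegrable (by fun_prop) 0 θ).1
  rw [intervalIntegral.integral_of_le h0, integral_Ioc_eq_integral_Ioo,
    ofReal_integral_eq_lintegral_ofReal (hint.mono_set Ioo_subset_Ioc_self)]
  filter_upwards [ae_restrict_mem measurableSet_Ioo] with φ hφ
  exact pow_nonneg (Real.sin_nonneg_of_nonneg_of_le_pi hφ.1.le (hφ.2.le.trans hπ)) m

section RadialIntegration

variable {F : Type*} [NormedAddCommGroup F] [NormedSpace ℝ F] [FiniteDimensional ℝ F]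
  [MeasurableSpace F] [BorelSpace F]

/-- Integration of a radial function in polar coordinates, for the Lebesgue integral. -/
theorem lintegral_fun_norm_addHaar [Nontrivial F] (μ : Measure F) [μ.IsAddHaarMeasure]
    {f : ℝ → ℝ≥0∞} (hf : Measurable f) :
    ∫⁻ x, f ‖x‖ ∂μ =
      μ.toSphere univ * ∫⁻ r in Ioi (0 : ℝ), ENNReal.ofReal (r ^ (finrank ℝ F - 1)) * f r := by
  have hpow : Measurable fun r : Ioi (0 : ℝ) ↦ ENNReal.ofReal ((r : ℝ) ^ (finrank ℝ F - 1)) := by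
    fun_prop
  calc
    ∫⁻ x, f ‖x‖ ∂μ = ∫⁻ x : ({0}ᶜ : Set F), f ‖x.1‖ ∂(μ.comap (↑)) := by
      rw [lintegral_subtype_comap (measurableSet_singleton _).compl fun x ↦ f ‖x‖,
        restrict_compl_singleton]
    _ = ∫⁻ x, f x.2 ∂μ.toSphere.prod (volumeIoiPow (finrank ℝ F - 1)) := by
      simpa using μ.measurePreserving_homeomorphUnitSphereProd.lintegral_comp_emb
        (Homeomorph.measurableEmbedding _) (f ∘ Subtype.val ∘ Prod.snd)
    _ = μ.toSphere univ * ∫⁻ r : Ioi (0 : ℝ), f r ∂volumeIoiPow (finrank ℝ F - 1) := by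
      rw [lintegral_prod _ (by fun_prop)]
      simp only [lintegral_const, mul_comm]
    _ = _ := by
      rw [volumeIoiPow, lintegral_withDensity_eq_lintegral_mul _ hpow (by fun_prop)]
      congr 1
      exact lintegral_subtype_comap measurableSet_Ioi
        fun r ↦ ENNReal.ofReal (r ^ (finrank ℝ F - 1)) * f r

end RadialIntegration

section AxialIntegration

variable {E : Type*} [NormedAddCommGroup E] [InnerProductSpace ℝ E] [FiniteDimensional ℝ E]
  [MeasurableSpace E] [BorelSpace E]

/-- Splitting off the component along a unit vector preserves volume. -/
theorem measurePreserving_inner_orthogonalProjection {u : E} (hu : ‖u‖ = 1) :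
    MeasurePreserving fun x : E ↦ (⟪u, x⟫, (ℝ ∙ u)ᗮ.orthogonalProjectionOnto x) := by
  have h := ((LinearIsometryEquiv.toSpanUnitSingleton (𝕜 := ℝ) u hu).symm.measurePreserving.prod
    (MeasurePreserving.id (volume : Measure (ℝ ∙ u)ᗮ))).comp
    ((WithLp.volume_preserving_ofLp (ℝ ∙ u) (ℝ ∙ u)ᗮ).comp
      ((ℝ ∙ u).orthogonalDecomposition).measurePreserving)
  convert! h using 1
  ext x
  · simp only [Function.comp_apply, Prod.map_fst, Submodule.orthogonalDecomposition_apply]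
    rw [eq_comm, LinearIsometryEquiv.symm_apply_eq]
    ext
    simp [Submodule.starProjection_unit_singleton ℝ hu]
  · simp

/-- Integration of a function invariant under the rotations fixing a unit vector. -/
theorem lintegral_inner_norm_orthogonalProjection {m : ℕ} (hE : finrank ℝ E = m + 2) {u : E}
    (hu : ‖u‖ = 1) {G : ℝ × ℝ → ℝ≥0∞} (hG : Measurable G) :
    ∫⁻ x : E, G (⟪u, x⟫, ‖(ℝ ∙ u)ᗮ.orthogonalProjectionOnto x‖) =
      (volume : Measure (ℝ ∙ u)ᗮ).toSphere univ *
        ∫⁻ p : ℝ × ℝ, (univ ×ˢ Ioi (0 : ℝ)).indicator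
          (fun p ↦ ENNReal.ofReal (p.2 ^ m) * G p) p := by
  have hdim : finrank ℝ (ℝ ∙ u)ᗮ = m + 1 :=
    haveI : Fact (finrank ℝ E = (m + 1) + 1) := ⟨hE⟩
    Submodule.finrank_orthogonal_span_singleton (by rintro rfl; simp at hu)
  have : Nontrivial (ℝ ∙ u)ᗮ := nontrivial_of_finrank_pos (R := ℝ) (by omega)
  calc
    _ = ∫⁻ q : ℝ × (ℝ ∙ u)ᗮ, G (q.1, ‖q.2‖) :=
      (measurePreserving_inner_orthogonalProjection hu).lintegral_comp
        (f := fun q ↦ G (q.1, ‖q.2‖)) (by fun_prop)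
    _ = ∫⁻ s : ℝ, ∫⁻ y : (ℝ ∙ u)ᗮ, G (s, ‖y‖) := by
      rw [volume_eq_prod, lintegral_prod _ (by fun_prop)]
    _ = ∫⁻ s : ℝ, (volume : Measure (ℝ ∙ u)ᗮ).toSphere univ *
          ∫⁻ r in Ioi (0 : ℝ), ENNReal.ofReal (r ^ m) * G (s, r) := by
      refine lintegral_congr fun s ↦ ?_
      rw [lintegral_fun_norm_addHaar volume (f := fun r ↦ G (s, r)) (by fun_prop), hdim,
        Nat.add_sub_cancel]
    _ = _ := by
      rw [lintegral_const_mul' _ _ (measure_ne_top _ _),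
        lintegral_indicator (MeasurableSet.univ.prod measurableSet_Ioi),
        volume_eq_prod, ← prod_restrict, restrict_univ, lintegral_prod _ (by fun_prop)]

/-- The volume of a union of radii of the unit ball whose angle with a fixed unit vector is
prescribed, up to a factor that does not depend on the angles. -/
theorem exists_volume_sector_eq {m : ℕ} (hE : finrank ℝ E = m + 2) {u : E} (hu : ‖u‖ = 1) :
    ∃ K : ℝ≥0∞, ∀ S : Set ℝ, MeasurableSet S →
      volume {x : E | ‖x‖ < 1 ∧ ⟪u, x⟫ / ‖x‖ ∈ S} =
        K * ∫⁻ φ in Ioo 0 Real.pi,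
          S.indicator 1 (Real.cos φ) * ENNReal.ofReal (Real.sin φ ^ m) := by
  refine ⟨(volume : Measure (ℝ ∙ u)ᗮ).toSphere univ *
    ∫⁻ ρ in Ioi (0 : ℝ), (Iio (1 : ℝ)).indicator (fun ρ ↦ ENNReal.ofReal (ρ ^ (m + 1))) ρ,
    fun S hS ↦ ?_⟩
  set T : Set (ℝ × ℝ) := {p | √(p.1 ^ 2 + p.2 ^ 2) < 1 ∧ p.1 / √(p.1 ^ 2 + p.2 ^ 2) ∈ S}
    with hTdef
  have hT : MeasurableSet T := by
    refine .inter (s₁ := {p : ℝ × ℝ | √(p.1 ^ 2 + p.2 ^ 2) < 1})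
      (measurableSet_lt (by fun_prop) measurable_const) ?_
    exact (show Measurable fun p : ℝ × ℝ ↦ p.1 / √(p.1 ^ 2 + p.2 ^ 2) by fun_prop) hS
  have hnorm (x : E) :
      √(⟪u, x⟫ ^ 2 + ‖(ℝ ∙ u)ᗮ.orthogonalProjectionOnto x‖ ^ 2) = ‖x‖ := by
    rw [← Real.sqrt_sq (norm_nonneg x), (ℝ ∙ u).norm_sq_eq_add_norm_sq_projection x]
    congr 2
    rw [← Submodule.norm_coe, ← Submodule.starProjection_apply,
      Submodule.starProjection_unit_singleton ℝ hu, norm_smul, hu, mul_one, Real.norm_eq_abs, sq_abs]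
  have hset : {x : E | ‖x‖ < 1 ∧ ⟪u, x⟫ / ‖x‖ ∈ S} =
      (fun x : E ↦ (⟪u, x⟫, ‖(ℝ ∙ u)ᗮ.orthogonalProjectionOnto x‖)) ⁻¹' T := by
    ext x
    simp only [hTdef, mem_preimage, mem_ofPred_eq, hnorm]
  have hmeas : Measurable fun x : E ↦ (⟪u, x⟫, ‖(ℝ ∙ u)ᗮ.orthogonalProjectionOnto x‖) := by
    fun_prop
  rw [hset, ← lintegral_indicator_one (hmeas hT)]
  have key := lintegral_inner_norm_orthogonalProjection hE hu (G := T.indicator 1)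
    (measurable_one.indicator hT)
  refine key.trans ?_
  rw [mul_assoc]
  congr 1
  rw [← lintegral_comp_polarCoord_symm, polarCoord_target]
  have hIoo : Ioo 0 Real.pi ⊆ Ioo (-Real.pi) Real.pi :=
    Ioo_subset_Ioo_left (by linarith [Real.pi_pos])
  calc
    _ = ∫⁻ p in Ioi (0 : ℝ) ×ˢ Ioo (-Real.pi) Real.pi,
          (Iio (1 : ℝ)).indicator (fun ρ ↦ ENNReal.ofReal (ρ ^ (m + 1))) p.1 *
          (Ioo 0 Real.pi).indicator
            (fun φ ↦ S.indicator 1 (Real.cos φ) * ENNReal.ofReal (Real.sin φ ^ m)) p.2 := by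
      refine setLIntegral_congr_fun (measurableSet_Ioi.prod measurableSet_Ioo) ?_
      rintro ⟨ρ, φ⟩ ⟨hρ : 0 < ρ, hφ : -Real.pi < φ ∧ φ < Real.pi⟩
      have hsqrt : √((ρ * Real.cos φ) ^ 2 + (ρ * Real.sin φ) ^ 2) = ρ := by
        rw [← Real.sqrt_sq hρ.le]
        congr 1
        rw [Real.sqrt_sq hρ.le]
        linear_combination ρ ^ 2 * Real.sin_sq_add_cos_sq φ
      have hmemT : (ρ * Real.cos φ, ρ * Real.sin φ) ∈ T ↔ ρ < 1 ∧ Real.cos φ ∈ S := by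
        simp [hTdef, hsqrt, mul_div_cancel_left₀ _ hρ.ne']
      simp only [polarCoord_symm_apply, smul_eq_mul]
      rcases le_or_gt φ 0 with h0 | h0
      · have h1 : ¬ 0 < ρ * Real.sin φ := by
          have := Real.sin_nonpos_of_nonpos_of_neg_pi_le h0 hφ.1.le
          nlinarith
        rw [indicator_of_notMem (by simpa using h1), indicator_of_notMem (s := Ioo 0 Real.pi)]
        · simp
        · simp [h0]
      · have hsin := Real.sin_pos_of_pos_of_lt_pi h0 hφ.2
        rw [indicator_of_mem (s := univ ×ˢ Ioi (0 : ℝ)) (by simpa using mul_pos hρ hsin),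
          indicator_of_mem (s := Ioo 0 Real.pi) ⟨h0, hφ.2⟩]
        by_cases h1 : ρ < 1
        · by_cases h2 : Real.cos φ ∈ S
          · rw [indicator_of_mem (hmemT.2 ⟨h1, h2⟩), indicator_of_mem h2,
              indicator_of_mem (s := Iio (1 : ℝ)) h1]
            simp only [Pi.one_apply, mul_one, one_mul]
            rw [← ENNReal.ofReal_mul hρ.le, ← ENNReal.ofReal_mul (by positivity)]
            congr 1
            ring
          · rw [indicator_of_notMem (fun h ↦ h2 (hmemT.1 h).2), indicator_of_notMem h2]
            simp
        · rw [indicator_of_notMem (fun h ↦ h1 (hmemT.1 h).1),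
            indicator_of_notMem (s := Iio (1 : ℝ)) h1]
          simp
    _ = _ := by
      rw [volume_eq_prod, ← prod_restrict, lintegral_prod_mul,
        setLIntegral_indicator measurableSet_Ioo,
        inter_eq_self_of_subset_left hIoo]
      · exact ((by fun_prop : Measurable fun ρ : ℝ ↦ ENNReal.ofReal (ρ ^ (m + 1))).indicator
          measurableSet_Iio).aemeasurable
      · refine (Measurable.indicator (.mul ?_ (by fun_prop)) measurableSet_Ioo).aemeasurable
        exact (measurable_one.indicator hS).comp Real.measurable_cos

/-- The volume of a spherical sector of angle `θ` of the unit ball, relative to the ball. -/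
theorem volume_real_sector_mul {m : ℕ} (hE : finrank ℝ E = m + 2) {u : E} (hu : ‖u‖ = 1)
    {θ : ℝ} (h0 : 0 ≤ θ) (hπ : θ ≤ Real.pi) :
    volume.real {x : E | ‖x‖ < 1 ∧ Real.cos θ < ⟪u, x⟫ / ‖x‖} *
        ∫ φ in (0 : ℝ)..Real.pi, Real.sin φ ^ m =
      volume.real (Metric.ball (0 : E) 1) * ∫ φ in (0 : ℝ)..θ, Real.sin φ ^ m := by
  obtain ⟨K, hK⟩ := exists_volume_sector_eq hE hu
  have hnonneg {θ : ℝ} (h0 : 0 ≤ θ) (hπ : θ ≤ Real.pi) :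
      0 ≤ ∫ φ in (0 : ℝ)..θ, Real.sin φ ^ m :=
    intervalIntegral.integral_nonneg h0 fun φ hφ ↦
      pow_nonneg (Real.sin_nonneg_of_nonneg_of_le_pi hφ.1 (hφ.2.trans hπ)) m
  have hball : volume (Metric.ball (0 : E) 1) =
      K * ENNReal.ofReal (∫ φ in (0 : ℝ)..Real.pi, Real.sin φ ^ m) := by
    rw [← lintegral_Ioo_sin_pow m Real.pi_pos.le le_rfl]
    convert! hK univ .univ using 2
    · ext x; simp
    · simp
  have hsector : volume {x : E | ‖x‖ < 1 ∧ Real.cos θ < ⟪u, x⟫ / ‖x‖} =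
      K * ENNReal.ofReal (∫ φ in (0 : ℝ)..θ, Real.sin φ ^ m) := by
    rw [← lintegral_Ioo_sin_pow m h0 hπ]
    refine (hK (Ioi (Real.cos θ)) measurableSet_Ioi).trans ?_
    congr 1
    have hsub : Ioo 0 θ ⊆ Ioo 0 Real.pi := Ioo_subset_Ioo_right hπ
    rw [← inter_eq_self_of_subset_left hsub, ← setLIntegral_indicator measurableSet_Ioo]
    refine setLIntegral_congr_fun measurableSet_Ioo fun φ hφ ↦ ?_
    have hiff : Real.cos φ ∈ Ioi (Real.cos θ) ↔ φ ∈ Ioo 0 θ := by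
      rw [mem_Ioi, Real.strictAntiOn_cos.lt_iff_gt ⟨h0, hπ⟩ ⟨hφ.1.le, hφ.2.le⟩]
      simp [hφ.1]
    by_cases h : φ ∈ Ioo 0 θ
    · simp only [indicator_of_mem h, indicator_of_mem (hiff.2 h), Pi.one_apply, one_mul]
    · simp only [indicator_of_notMem h, indicator_of_notMem (mt hiff.1 h), zero_mul]
  rw [measureReal_def, measureReal_def, hball, hsector, ENNReal.toReal_mul, ENNReal.toReal_mul,
    ENNReal.toReal_ofReal (hnonneg h0 hπ), ENNReal.toReal_ofReal (hnonneg Real.pi_pos.le le_rfl)]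
  ring

end AxialIntegration

/-- Sectors of angle `π / 6` around two unit vectors at angle at least `π / 3` do not meet. -/
theorem disjoint_sector {E : Type*} [NormedAddCommGroup E] [InnerProductSpace ℝ E] {u v : E}
    (hu : ‖u‖ = 1) (hv : ‖v‖ = 1) (huv : ⟪u, v⟫ ≤ 1 / 2) :
    Disjoint {x : E | ‖x‖ < 1 ∧ Real.cos (Real.pi / 6) < ⟪u, x⟫ / ‖x‖}
      {x : E | ‖x‖ < 1 ∧ Real.cos (Real.pi / 6) < ⟪v, x⟫ / ‖x‖} := by
  rw [Set.disjoint_left]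
  rintro x ⟨-, hxu⟩ ⟨-, hxv⟩
  rw [Real.cos_pi_div_six] at hxu hxv
  have hx : 0 < ‖x‖ := by
    rcases (norm_nonneg x).eq_or_lt with h | h
    · rw [← h, div_zero] at hxu
      exact absurd hxu (not_lt.2 (by positivity))
    · exact h
  rw [lt_div_iff₀ hx] at hxu hxv
  have hsum : √3 * ‖x‖ < ⟪u + v, x⟫ := by
    rw [inner_add_left]
    linarith
  have hnorm : ‖u + v‖ ≤ √3 := by
    refine Real.le_sqrt_of_sq_le ?_
    rw [norm_add_sq_real, hu, hv]
    linarith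
  have := real_inner_le_norm (u + v) x
  nlinarith

/-- The trigonometric form of the incomplete beta function with second parameter `1 / 2`. -/
theorem incBeta_sin_sq (m : ℕ) {θ : ℝ} (h0 : 0 ≤ θ) (hθ : θ ≤ Real.pi / 2) :
    incBeta (Real.sin θ ^ 2) ((m + 1) / 2) (1 / 2) = 2 * ∫ φ in (0 : ℝ)..θ, Real.sin φ ^ m := by
  have hpos {φ : ℝ} (hφ : φ ∈ Ioo 0 θ) : 0 < Real.sin φ ∧ 0 < Real.cos φ :=
    ⟨Real.sin_pos_of_pos_of_lt_pi hφ.1 (by linarith [hφ.2, Real.pi_pos]),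
      Real.cos_pos_of_mem_Ioo ⟨by linarith [hφ.1, Real.pi_pos], by linarith [hφ.2]⟩⟩
  have hmono : StrictMonoOn (fun φ ↦ Real.sin φ ^ 2) (Icc 0 θ) := by
    intro a ha b hb hab
    have hsin : Real.sin a < Real.sin b :=
      Real.sin_lt_sin_of_lt_of_le_pi_div_two (by linarith [ha.1, Real.pi_pos])
        (hb.2.trans hθ) hab
    exact pow_lt_pow_left₀ hsin
      (Real.sin_nonneg_of_nonneg_of_le_pi ha.1 (by linarith [ha.2, Real.pi_pos])) two_ne_zero
  have himage : (fun φ ↦ Real.sin φ ^ 2) '' Ioo 0 θ = Ioo 0 (Real.sin θ ^ 2) := by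
    apply Subset.antisymm
    · rintro _ ⟨φ, hφ, rfl⟩
      refine ⟨pow_pos (hpos hφ).1 2, ?_⟩
      exact hmono ⟨hφ.1.le, hφ.2.le⟩ ⟨h0, le_rfl⟩ hφ.2
    · have := intermediate_value_Ioo h0
        (f := fun φ ↦ Real.sin φ ^ 2) (by fun_prop)
      simpa using this
  rw [incBeta, intervalIntegral.integral_of_le (sq_nonneg _), intervalIntegral.integral_of_le h0,
    integral_Ioc_eq_integral_Ioo, integral_Ioc_eq_integral_Ioo, ← himage,
    integral_image_eq_integral_abs_deriv_smul (f' := fun φ ↦ 2 * Real.sin φ * Real.cos φ)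
      measurableSet_Ioo _ (hmono.injOn.mono Ioo_subset_Icc_self),
    ← integral_const_mul]
  · refine setIntegral_congr_fun measurableSet_Ioo fun φ hφ ↦ ?_
    obtain ⟨hs, hc⟩ := hpos hφ
    have h1 : (Real.sin φ ^ 2) ^ (((m : ℝ) + 1) / 2 - 1) = Real.sin φ ^ m / Real.sin φ := by
      rw [← Real.rpow_natCast (Real.sin φ) 2, ← Real.rpow_mul hs.le, ← Real.rpow_natCast _ m,
        ← Real.rpow_sub_one hs.ne']
      congr 1
      push_cast
      ring
    have h2 : (1 - Real.sin φ ^ 2) ^ ((1 : ℝ) / 2 - 1) = (Real.cos φ)⁻¹ := by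
      rw [← Real.cos_sq', ← Real.rpow_natCast (Real.cos φ) 2, ← Real.rpow_mul hc.le,
        ← Real.rpow_neg_one]
      norm_num
    simp only [smul_eq_mul]
    rw [h1, h2, abs_of_pos (by positivity)]
    field_simp
  · intro φ _
    have := ((Real.hasDerivAt_sin φ).fun_pow 2).hasDerivWithinAt (s := Ioo 0 θ)
    simpa using this

theorem integral_sin_pow_pos_of_le_pi (m : ℕ) {θ : ℝ} (h0 : 0 < θ) (hπ : θ ≤ Real.pi) :
    0 < ∫ φ in (0 : ℝ)..θ, Real.sin φ ^ m :=
  intervalIntegral.intervalIntegral_pos_of_pos_on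
    (Continuous.intervalIntegrable (by fun_prop) 0 θ)
    (fun _ hφ ↦ pow_pos (Real.sin_pos_of_pos_of_lt_pi hφ.1 (hφ.2.trans_le hπ)) m) h0

theorem integral_sin_pow_zero_pi (m : ℕ) :
    ∫ φ in (0 : ℝ)..Real.pi, Real.sin φ ^ m =
      2 * ∫ φ in (0 : ℝ)..(Real.pi / 2), Real.sin φ ^ m := by
  have hint (a b : ℝ) : IntervalIntegrable (fun φ ↦ Real.sin φ ^ m) volume a b :=
    Continuous.intervalIntegrable (by fun_prop) a b
  have hsymm := intervalIntegral.integral_comp_sub_left (a := 0) (b := Real.pi / 2)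
    (fun φ ↦ Real.sin φ ^ m) Real.pi
  simp only [Real.sin_pi_sub, sub_zero, sub_half] at hsymm
  rw [← intervalIntegral.integral_add_adjacent_intervals (hint 0 (Real.pi / 2)) (hint _ _),
    ← hsymm, two_mul]

/-- Corollary 2.5, upper-bound half: upper bound on the Euclidean kissing number. -/
theorem upper_bound_euclidean_kissing (n : ℕ) (hn : 2 ≤ n)
    (C : Finset (EuclideanSpace ℝ (Fin n)))
    (hC : IsSphericalCode n (1 / 2) C) :
    (C.card : ℝ) ≤
      2 * incBeta 1 ((n - 1) / 2) (1 / 2) / incBeta (1 / 4) ((n - 1) / 2) (1 / 2) := by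
  obtain ⟨m, rfl⟩ := Nat.exists_eq_add_of_le' hn
  have hπ := Real.pi_pos
  have hparam : (((m + 2 : ℕ) : ℝ) - 1) / 2 = (m + 1) / 2 := by push_cast; ring
  have hfull := incBeta_sin_sq m (θ := Real.pi / 2) (by linarith) le_rfl
  have hcap := incBeta_sin_sq m (θ := Real.pi / 6) (by linarith) (by linarith)
  rw [Real.sin_pi_div_two, one_pow] at hfull
  rw [Real.sin_pi_div_six, show ((1 : ℝ) / 2) ^ 2 = 1 / 4 by norm_num] at hcap
  have hWcap := integral_sin_pow_pos_of_le_pi m (θ := Real.pi / 6) (by linarith) (by linarith)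
  have hWfull := integral_sin_pow_pos_of_le_pi m hπ le_rfl
  rw [hparam, hfull, hcap, ← integral_sin_pow_zero_pi, mul_div_mul_left _ _ two_ne_zero,
    le_div_iff₀ hWcap]
  set sector : EuclideanSpace ℝ (Fin (m + 2)) → Set (EuclideanSpace ℝ (Fin (m + 2))) :=
    fun u ↦ {x | ‖x‖ < 1 ∧ Real.cos (Real.pi / 6) < ⟪u, x⟫ / ‖x‖}
  have hmeas (u) : MeasurableSet (sector u) :=
    MeasurableSet.inter (s₁ := {x | ‖x‖ < 1}) (s₂ := {x | Real.cos (Real.pi / 6) < ⟪u, x⟫ / ‖x‖})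
      (measurableSet_lt (by fun_prop) measurable_const)
      (measurableSet_lt measurable_const (by fun_prop))
  have hsub (u) : sector u ⊆ Metric.ball 0 1 := fun x hx ↦ by simpa using hx.1
  have hfin (u) : volume (sector u) ≠ ∞ :=
    ((measure_mono (hsub u)).trans_lt measure_ball_lt_top).ne
  have hpack : ∑ u ∈ C, volume.real (sector u) ≤
      volume.real (Metric.ball (0 : EuclideanSpace ℝ (Fin (m + 2))) 1) := by
    rw [← measureReal_biUnion_finset
      (fun u hu v hv huv ↦ disjoint_sector (hC.1 u hu) (hC.1 v hv) (hC.2 u hu v hv huv))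
      (fun u _ ↦ hmeas u) (fun u _ ↦ hfin u)]
    exact measureReal_mono (iUnion₂_subset fun u _ ↦ hsub u) measure_ball_lt_top.ne
  have hball : 0 < volume.real (Metric.ball (0 : EuclideanSpace ℝ (Fin (m + 2))) 1) :=
    ENNReal.toReal_pos (Metric.measure_ball_pos _ _ one_pos).ne' measure_ball_lt_top.ne
  have hsum := mul_le_mul_of_nonneg_right hpack hWfull.le
  rw [Finset.sum_mul, Finset.sum_congr rfl fun u hu ↦ volume_real_sector_mul (by simp)
    (hC.1 u hu) (θ := Real.pi / 6) (by linarith) (by linarith), Finset.sum_const, nsmul_eq_mul,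
    mul_left_comm] at hsum
  exact le_of_mul_le_mul_left hsum hball
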